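/- Take a ≡ 1 and p > 2. Let U : [R₀,R₁] → ℝ be continuous with U ≥ 0, and set u_rad(x) := U(|x|) on the closure of A. Let α ∈ ℝ and let w : [R₀,R₁] → ℝ be C¹ on [R₀,R₁] and C² on (R₀,R₁), with w > 0 on (R₀,R₁), w(R₀) = w(R₁) = 0, and −w''(r) − ((N−1)/r) w'(r) + (1 − (p−1)U(r)^{p−2}) w(r) = (α/r²) w(r) for all r ∈ (R₀,R₁). Assume α + 2N < 0. Then the function v(x) := w(|x|)(1 − N x_N²/|x|²) belongs to C¹₀(A), is axially symmetric with 𝔳(r,θ) = w(r)(1 − N sin²θ), and satisfies: (1) ∫_A (|∇v|² + v² − (p−1) u_rad^{p−2} v²) dx < 0; (2) θ ↦ 𝔳(r,θ) is nonincreasing on [0,π/2] for every r ∈ [R₀,R₁]; (3) 𝔳(r,θ) = 𝔳(r,−θ); (4) ∫_{S^{N−1}} v(rσ) dσ(σ) = 0 for every r ∈ (R₀,R₁), where dσ is the surface measure on the unit sphere S^{N−1}. -/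

import Mathlib

open MeasureTheory Real Set

noncomputable section

/-- The open annulus `{x : R₀ < |x| < R₁}` in `ℝ^N`. -/
def annulus (N : ℕ) (R₀ R₁ : ℝ) : Set (EuclideanSpace ℝ (Fin N)) :=
  {x | R₀ < ‖x‖ ∧ ‖x‖ < R₁}

/-- The last coordinate `x_N` of a point of `ℝ^N`. -/
def lastCoord {N : ℕ} (x : EuclideanSpace ℝ (Fin N)) : ℝ :=
  if h : 0 < N then x ⟨N - 1, by omega⟩ else 0

/-- The polar angle `θ = arcsin (x_N / |x|)`. -/
def angleOf {N : ℕ} (x : EuclideanSpace ℝ (Fin N)) : ℝ :=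
  Real.arcsin (lastCoord x / ‖x‖)

/-- `u` is axially symmetric on the closed annulus with representative `𝔲 = 𝔲(r,θ)`. -/
def IsAxiallySymmRep (N : ℕ) (R₀ R₁ : ℝ) (u : EuclideanSpace ℝ (Fin N) → ℝ)
    (𝔲 : ℝ → ℝ → ℝ) : Prop :=
  ∀ x ∈ closure (annulus N R₀ R₁), u x = 𝔲 ‖x‖ (angleOf x)

/-- Membership in the cone `K̂`: `C¹` on the closed annulus, nonnegative, axially symmetric,
even in `θ` and nonincreasing in `θ` on `[0, π/2]`. -/
def memKhat (N : ℕ) (R₀ R₁ : ℝ) (u : EuclideanSpace ℝ (Fin N) → ℝ) : Prop :=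
  ContDiffOn ℝ 1 u (closure (annulus N R₀ R₁)) ∧
  (∀ x ∈ closure (annulus N R₀ R₁), 0 ≤ u x) ∧
  ∃ 𝔲 : ℝ → ℝ → ℝ,
    IsAxiallySymmRep N R₀ R₁ u 𝔲 ∧
    (∀ r ∈ Icc R₀ R₁, ∀ θ ∈ Icc (-(π / 2)) (π / 2), 𝔲 r (-θ) = 𝔲 r θ) ∧
    (∀ r ∈ Icc R₀ R₁, AntitoneOn (𝔲 r) (Icc 0 (π / 2)))

/-- `C¹₀(A)` : `C¹` on the closed annulus, vanishing on the boundary. -/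
def memC10 (N : ℕ) (R₀ R₁ : ℝ) (u : EuclideanSpace ℝ (Fin N) → ℝ) : Prop :=
  ContDiffOn ℝ 1 u (closure (annulus N R₀ R₁)) ∧
  ∀ x : EuclideanSpace ℝ (Fin N), (‖x‖ = R₀ ∨ ‖x‖ = R₁) → u x = 0

/-- The cone `K = K̂ ∩ C¹₀(A)`. -/
def memK (N : ℕ) (R₀ R₁ : ℝ) (u : EuclideanSpace ℝ (Fin N) → ℝ) : Prop :=
  memKhat N R₀ R₁ u ∧ ∀ x : EuclideanSpace ℝ (Fin N), (‖x‖ = R₀ ∨ ‖x‖ = R₁) → u x = 0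

/-- The squared `H¹(A)`-norm `∫_A (|∇u|² + u²) dx`. -/
def H1sq (N : ℕ) (R₀ R₁ : ℝ) (u : EuclideanSpace ℝ (Fin N) → ℝ) : ℝ :=
  ∫ x in annulus N R₀ R₁,
    (‖fderivWithin ℝ u (closure (annulus N R₀ R₁)) x‖ ^ 2 + (u x) ^ 2)

/-- The energy functional `I(u) = ½‖u‖²_{H¹} − (1/p) ∫_A a |u|^p`. -/
def funcI (N : ℕ) (R₀ R₁ : ℝ) (a : EuclideanSpace ℝ (Fin N) → ℝ) (p : ℝ)
    (u : EuclideanSpace ℝ (Fin N) → ℝ) : ℝ :=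
  (1 / 2) * H1sq N R₀ R₁ u - (1 / p) * ∫ x in annulus N R₀ R₁, a x * |u x| ^ p

/-- The Nehari set `N_K`. -/
def memNehari (N : ℕ) (R₀ R₁ : ℝ) (a : EuclideanSpace ℝ (Fin N) → ℝ) (p : ℝ)
    (u : EuclideanSpace ℝ (Fin N) → ℝ) : Prop :=
  memK N R₀ R₁ u ∧ (∃ x ∈ annulus N R₀ R₁, u x ≠ 0) ∧
  H1sq N R₀ R₁ u = ∫ x in annulus N R₀ R₁, a x * |u x| ^ p

/-- The Nehari level `c_I = inf_{N_K} I`. -/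
def cI (N : ℕ) (R₀ R₁ : ℝ) (a : EuclideanSpace ℝ (Fin N) → ℝ) (p : ℝ) : ℝ :=
  sInf {c | ∃ u, memNehari N R₀ R₁ a p u ∧ c = funcI N R₀ R₁ a p u}

/-- Test functions `C_c^∞(A)`. -/
def IsTestFun (N : ℕ) (R₀ R₁ : ℝ) (φ : EuclideanSpace ℝ (Fin N) → ℝ) : Prop :=
  ContDiff ℝ (⊤ : ℕ∞) φ ∧ HasCompactSupport φ ∧ tsupport φ ⊆ annulus N R₀ R₁

/-- Weak solution of `−Δu + u = a(x)|u|^{p−2}u` in `A`, `u = 0` on `∂A`. -/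
def IsWeakSolution (N : ℕ) (R₀ R₁ : ℝ) (a : EuclideanSpace ℝ (Fin N) → ℝ) (p : ℝ)
    (u : EuclideanSpace ℝ (Fin N) → ℝ) : Prop :=
  memC10 N R₀ R₁ u ∧
  ∀ φ : EuclideanSpace ℝ (Fin N) → ℝ, IsTestFun N R₀ R₁ φ →
    (∫ x in annulus N R₀ R₁,
      (fderivWithin ℝ u (closure (annulus N R₀ R₁)) x (gradient φ x) + u x * φ x))
    = ∫ x in annulus N R₀ R₁, a x * |u x| ^ (p - 2) * u x * φ x

/-- The (classical) Laplacian, as the sum of second partial derivatives. -/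
def lapl {N : ℕ} (u : EuclideanSpace ℝ (Fin N) → ℝ) (x : EuclideanSpace ℝ (Fin N)) : ℝ :=
  ∑ i : Fin N,
    fderiv ℝ (fun y => fderiv ℝ u y (EuclideanSpace.single i 1)) x (EuclideanSpace.single i 1)

/-- The inclusion `ℝ^{N-1} → ℝ^N`, `x' ↦ (x',0)`. -/
def embedHyper (N : ℕ) (x' : EuclideanSpace ℝ (Fin (N - 1))) : EuclideanSpace ℝ (Fin N) :=
  (WithLp.equiv 2 (Fin N → ℝ)).symm
    (fun j => if h : (j : ℕ) < N - 1 then x' ⟨j, h⟩ else 0)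

/-- A `C¹` distance on the closed annulus. -/
def C1dist (N : ℕ) (R₀ R₁ : ℝ) (u v : EuclideanSpace ℝ (Fin N) → ℝ) : ℝ :=
  (⨆ x : closure (annulus N R₀ R₁), |u x - v x|) +
  (⨆ x : closure (annulus N R₀ R₁),
    ‖fderivWithin ℝ u (closure (annulus N R₀ R₁)) x
      - fderivWithin ℝ v (closure (annulus N R₀ R₁)) x‖)

end

lemma s15_annulus_meas (N : ℕ) (R₀ R₁ : ℝ) : IsOpen (annulus N R₀ R₁) :=
  (isOpen_lt continuous_const continuous_norm).inter (isOpen_lt continuous_norm continuous_const)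

lemma s15_closed_sub (N : ℕ) (R₀ R₁ : ℝ) :
    closure (annulus N R₀ R₁) ⊆ {x | ‖x‖ ∈ Icc R₀ R₁} := by
  apply closure_minimal
  · intro x hx
    exact ⟨hx.1.le, hx.2.le⟩
  · exact isClosed_Icc.preimage continuous_norm

lemma s15_compact (N : ℕ) (R₀ R₁ : ℝ) :
    IsCompact {x : EuclideanSpace ℝ (Fin N) | ‖x‖ ∈ Icc R₀ R₁} := by
  apply Metric.isCompact_of_isClosed_isBounded
  · exact isClosed_Icc.preimage continuous_norm
  · apply (Metric.isBounded_closedBall (x := (0 : EuclideanSpace ℝ (Fin N))) (r := R₁)).subset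
    intro x hx
    simpa using hx.2

lemma s15_integrable (N : ℕ) (R₀ R₁ : ℝ) (f : EuclideanSpace ℝ (Fin N) → ℝ)
    (hf : ContinuousOn f {x | ‖x‖ ∈ Icc R₀ R₁}) : IntegrableOn f (annulus N R₀ R₁) := by
  apply (hf.integrableOn_compact (s15_compact N R₀ R₁)).mono_set
  intro x hx
  exact ⟨hx.1.le, hx.2.le⟩

/-- Rotation invariance of the moments. -/
lemma s15_rot (N : ℕ) (R₀ R₁ : ℝ) (f : ℝ → ℝ → ℝ) (e e' : EuclideanSpace ℝ (Fin N))
    (h : ‖e‖ = ‖e'‖) :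
    ∫ x in annulus N R₀ R₁, f ‖x‖ (inner ℝ e x) = ∫ x in annulus N R₀ R₁, f ‖x‖ (inner ℝ e' x) := by
  set φ := (ℝ ∙ (e - e'))ᗮ.reflection
  have hφ : φ e = e' := Submodule.reflection_sub h
  have h1 := φ.measurePreserving.setIntegral_preimage_emb
    φ.toHomeomorph.measurableEmbedding (fun x => f ‖x‖ (inner ℝ e' x)) (annulus N R₀ R₁)
  have h2 : φ ⁻¹' (annulus N R₀ R₁) = annulus N R₀ R₁ := by
    ext x
    simp [annulus]
  rw [h2] at h1
  rw [← h1]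
  congr 1
  ext x
  rw [← hφ]
  simp

lemma s15_rot_coord (N : ℕ) (R₀ R₁ : ℝ) (f : ℝ → ℝ → ℝ) (i j : Fin N) :
    ∫ x in annulus N R₀ R₁, f ‖x‖ (x i) = ∫ x in annulus N R₀ R₁, f ‖x‖ (x j) := by
  have := s15_rot N R₀ R₁ f (EuclideanSpace.single i 1) (EuclideanSpace.single j 1) (by simp)
  simpa [EuclideanSpace.inner_single_left] using this

lemma s15_cont_norm {N : ℕ} {R₀ R₁ : ℝ} {H : ℝ → ℝ} (hH : ContinuousOn H (Icc R₀ R₁)) :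
    ContinuousOn (fun x : EuclideanSpace ℝ (Fin N) => H ‖x‖) {x | ‖x‖ ∈ Icc R₀ R₁} :=
  hH.comp continuous_norm.continuousOn (fun _ hx => hx)

lemma s15_A2 (N : ℕ) (R₀ R₁ : ℝ) (H : ℝ → ℝ) (hH : ContinuousOn H (Icc R₀ R₁)) (i : Fin N) :
    N * ∫ x in annulus N R₀ R₁, H ‖x‖ * x i ^ 2 = ∫ x in annulus N R₀ R₁, H ‖x‖ * ‖x‖ ^ 2 := by
  have h1 : ∀ x : EuclideanSpace ℝ (Fin N), H ‖x‖ * ‖x‖ ^ 2 = ∑ j, H ‖x‖ * x j ^ 2 := by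
    intro x
    rw [EuclideanSpace.real_norm_sq_eq, Finset.mul_sum]
  simp_rw [h1]
  rw [integral_finsetSum]
  · rw [Finset.sum_congr rfl (fun j _ => s15_rot_coord N R₀ R₁ (fun r t => H r * t ^ 2) j i)]
    simp
  · intro j _
    apply s15_integrable
    exact (s15_cont_norm hH).mul (by fun_prop)

lemma s15_A22 (N : ℕ) (R₀ R₁ : ℝ) (H : ℝ → ℝ) (hH : ContinuousOn H (Icc R₀ R₁)) (i j : Fin N)
    (hij : i ≠ j) :
    ∫ x in annulus N R₀ R₁, H ‖x‖ * x i ^ 4 =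
      3 * ∫ x in annulus N R₀ R₁, H ‖x‖ * (x i ^ 2 * x j ^ 2) := by
  have I1 : ∀ k : Fin N, IntegrableOn (fun x => H ‖x‖ * x k ^ 4) (annulus N R₀ R₁) := fun k =>
    s15_integrable _ _ _ _ ((s15_cont_norm hH).mul (by fun_prop))
  have I2 : IntegrableOn (fun x => H ‖x‖ * (x i ^ 2 * x j ^ 2)) (annulus N R₀ R₁) :=
    s15_integrable _ _ _ _ ((s15_cont_norm hH).mul (by fun_prop))
  have I3 : IntegrableOn (fun x => H ‖x‖ * (x i + x j) ^ 4) (annulus N R₀ R₁) :=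
    s15_integrable _ _ _ _ ((s15_cont_norm hH).mul (by fun_prop))
  have I4 : IntegrableOn (fun x => H ‖x‖ * (x i - x j) ^ 4) (annulus N R₀ R₁) :=
    s15_integrable _ _ _ _ ((s15_cont_norm hH).mul (by fun_prop))
  set ei : EuclideanSpace ℝ (Fin N) := EuclideanSpace.single i 1 with hei
  set ej : EuclideanSpace ℝ (Fin N) := EuclideanSpace.single j 1 with hej
  have nij : inner ℝ ei ej = 0 := by simp [hei, hej, EuclideanSpace.inner_single_left, hij]
  have ni : ‖ei‖ = 1 := by simp [hei]
  have nj : ‖ej‖ = 1 := by simp [hej]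
  have np : ‖ei + ej‖ = √2 := by
    rw [eq_comm, Real.sqrt_eq_iff_eq_sq (by norm_num) (norm_nonneg _), norm_add_sq_real, nij, ni, nj]
    norm_num
  have nm : ‖ei - ej‖ = √2 := by
    rw [eq_comm, Real.sqrt_eq_iff_eq_sq (by norm_num) (norm_nonneg _), norm_sub_sq_real, nij, ni, nj]
    norm_num
  have ns : ‖(√2) • ei‖ = √2 := by
    rw [norm_smul, ni]; simp
  have s4 : (√2) ^ 4 = 4 := by
    rw [show (√2) ^ 4 = ((√2) ^ 2) ^ 2 by ring, Real.sq_sqrt (by norm_num)]; norm_num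
  have A := s15_rot N R₀ R₁ (fun r t => H r * t ^ 4) (ei + ej) ((√2) • ei) (np.trans ns.symm)
  have B := s15_rot N R₀ R₁ (fun r t => H r * t ^ 4) (ei - ej) ((√2) • ei) (nm.trans ns.symm)
  have C := s15_rot_coord N R₀ R₁ (fun r t => H r * t ^ 4) j i
  simp only [inner_add_left, inner_sub_left, inner_smul_left, hei, hej,
    EuclideanSpace.inner_single_left, map_one, one_mul, mul_pow, conj_trivial, s4] at A B C
  have D : (fun x : EuclideanSpace ℝ (Fin N) => H ‖x‖ * (x i + x j) ^ 4 + H ‖x‖ * (x i - x j) ^ 4)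
      = fun x => (2 * (H ‖x‖ * x i ^ 4) + 2 * (H ‖x‖ * x j ^ 4))
        + 12 * (H ‖x‖ * (x i ^ 2 * x j ^ 2)) := by
    ext x; ring
  have D2 := integral_add I3 I4
  have I5 : IntegrableOn (fun x => 2 * (H ‖x‖ * x i ^ 4) + 2 * (H ‖x‖ * x j ^ 4))
      (annulus N R₀ R₁) := ((I1 i).const_mul 2).add ((I1 j).const_mul 2)
  rw [D, integral_add I5 (I2.const_mul 12),
    integral_add ((I1 i).const_mul 2) ((I1 j).const_mul 2), integral_const_mul, integral_const_mul,
    integral_const_mul, A, B, C] at D2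
  have E : ∫ x in annulus N R₀ R₁, H ‖x‖ * (4 * x i ^ 4)
      = 4 * ∫ x in annulus N R₀ R₁, H ‖x‖ * x i ^ 4 := by
    rw [← integral_const_mul]; congr 1; ext x; ring
  rw [E] at D2
  linarith

lemma s15_A4 (N : ℕ) (R₀ R₁ : ℝ) (H : ℝ → ℝ) (hH : ContinuousOn H (Icc R₀ R₁)) (i : Fin N) :
    N * (N + 2) * ∫ x in annulus N R₀ R₁, H ‖x‖ * x i ^ 4
      = 3 * ∫ x in annulus N R₀ R₁, H ‖x‖ * ‖x‖ ^ 4 := by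
  have h2 := s15_A2 N R₀ R₁ (fun r => H r * r ^ 2) (hH.mul (by fun_prop)) i
  have h1 : ∀ x : EuclideanSpace ℝ (Fin N), H ‖x‖ * ‖x‖ ^ 2 * x i ^ 2
      = ∑ j, H ‖x‖ * (x i ^ 2 * x j ^ 2) := by
    intro x
    rw [EuclideanSpace.real_norm_sq_eq, ← Finset.mul_sum, ← Finset.mul_sum]
    ring
  have h4 : ∀ x : EuclideanSpace ℝ (Fin N), H ‖x‖ * ‖x‖ ^ 2 * ‖x‖ ^ 2 = H ‖x‖ * ‖x‖ ^ 4 := by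
    intro x; ring
  simp only [h1, h4] at h2
  rw [integral_finsetSum] at h2
  · rw [← h2, ← Finset.add_sum_erase _ _ (Finset.mem_univ i)]
    have h3 : ∀ j ∈ Finset.univ.erase i,
        ∫ x in annulus N R₀ R₁, H ‖x‖ * (x i ^ 2 * x j ^ 2)
          = (1 / 3) * ∫ x in annulus N R₀ R₁, H ‖x‖ * x i ^ 4 := by
      intro j hj
      rw [s15_A22 N R₀ R₁ H hH i j (Finset.ne_of_mem_erase hj).symm]
      ring
    rw [Finset.sum_congr rfl h3]
    have h5 : ∫ x in annulus N R₀ R₁, H ‖x‖ * (x i ^ 2 * x i ^ 2)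
        = ∫ x in annulus N R₀ R₁, H ‖x‖ * x i ^ 4 := by
      congr 1; ext x; ring
    rw [h5, Finset.sum_const, Finset.card_erase_of_mem (Finset.mem_univ i), Finset.card_univ,
      Fintype.card_fin, nsmul_eq_mul, Nat.cast_sub (Nat.one_le_of_lt i.pos)]
    push_cast
    ring
  · intro j _
    exact s15_integrable _ _ _ _ ((s15_cont_norm hH).mul (by fun_prop))

lemma s15_polar (N : ℕ) (hN : 3 ≤ N) (k : ℝ → ℝ) (h : EuclideanSpace ℝ (Fin N) → ℝ) :
    ∫ x : EuclideanSpace ℝ (Fin N), h (‖x‖⁻¹ • x) * k ‖x‖ =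
      (∫ σ : Metric.sphere (0 : EuclideanSpace ℝ (Fin N)) 1, h σ
        ∂((volume : Measure (EuclideanSpace ℝ (Fin N))).toSphere)) *
      ∫ y : Ioi (0 : ℝ), k y ∂(Measure.volumeIoiPow
        (Module.finrank ℝ (EuclideanSpace ℝ (Fin N)) - 1)) := by
  have : Nonempty (Fin N) := ⟨⟨0, by omega⟩⟩
  have hne : Nontrivial (EuclideanSpace ℝ (Fin N)) := inferInstance
  rw [← integral_prod_mul (fun σ : Metric.sphere (0 : EuclideanSpace ℝ (Fin N)) 1 => h σ)
    (fun y : Ioi (0 : ℝ) => k y)]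
  rw [← (volume : Measure (EuclideanSpace ℝ (Fin N))).measurePreserving_homeomorphUnitSphereProd.integral_comp
    (Homeomorph.measurableEmbedding _)]
  simp only [homeomorphUnitSphereProd_apply_fst_coe, homeomorphUnitSphereProd_apply_snd_coe]
  rw [integral_subtype_comap (measurableSet_singleton _).compl fun x => h (‖x‖⁻¹ • x) * k ‖x‖,
        restrict_compl_singleton]

lemma s15_sphere (N : ℕ) (hN : 3 ≤ N) (i : Fin N) :
    ∫ σ : Metric.sphere (0 : EuclideanSpace ℝ (Fin N)) 1,
      (1 - N * (σ : EuclideanSpace ℝ (Fin N)) i ^ 2)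
        ∂((volume : Measure (EuclideanSpace ℝ (Fin N))).toSphere) = 0 := by
  have hA : MeasurableSet (annulus N 1 2) := (s15_annulus_meas N 1 2).measurableSet
  set k : ℝ → ℝ := (Ioo (1 : ℝ) 2).indicator 1 with hk
  have hind : ∀ f : EuclideanSpace ℝ (Fin N) → ℝ,
      ∫ x, f x * k ‖x‖ = ∫ x in annulus N 1 2, f x := by
    intro f
    rw [← integral_indicator hA]
    congr 1
    ext x
    by_cases hx : x ∈ annulus N 1 2
    · have hx' : ‖x‖ ∈ Ioo (1 : ℝ) 2 := hx
      rw [indicator_of_mem hx, hk, indicator_of_mem hx']; simp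
    · have hx' : ‖x‖ ∉ Ioo (1 : ℝ) 2 := hx
      rw [indicator_of_notMem hx, hk, indicator_of_notMem hx']; simp
  have P1 := s15_polar N hN k (fun _ => 1)
  have P2 := s15_polar N hN k (fun x => 1 - N * x i ^ 2)
  rw [hind (fun _ => 1)] at P1
  rw [hind (fun x => 1 - N * (‖x‖⁻¹ • x).ofLp i ^ 2)] at P2
  have h0 : ∫ x in annulus N 1 2, (1 - N * (‖x‖⁻¹ • x).ofLp i ^ 2) = 0 := by
    have hc : ContinuousOn (fun r : ℝ => (r ^ 2)⁻¹) (Icc 1 2) := by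
      apply ContinuousOn.inv₀ (by fun_prop)
      intro x hx
      have : 0 < x := by linarith [hx.1]
      positivity
    have h1 := s15_A2 N 1 2 (fun r => (r ^ 2)⁻¹) hc i
    have h2 : ∫ x in annulus N 1 2, (‖x‖ ^ 2)⁻¹ * ‖x‖ ^ 2 = ∫ x in annulus N 1 2, (1 : ℝ) := by
      apply setIntegral_congr_fun hA
      intro x hx
      have : 0 < ‖x‖ := by linarith [hx.1]
      simp only
      field_simp
    have h3 : ∀ x : EuclideanSpace ℝ (Fin N), (1 - N * (‖x‖⁻¹ • x).ofLp i ^ 2)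
        = 1 - N * ((‖x‖ ^ 2)⁻¹ * x i ^ 2) := by
      intro x
      simp [mul_pow]
    simp_rw [h3]
    rw [integral_sub, integral_const_mul, h1, h2, sub_self]
    · exact s15_integrable _ _ _ _ continuousOn_const
    · exact (s15_integrable _ _ _ _ ((s15_cont_norm hc).mul (by fun_prop))).const_mul _
  rw [h0] at P2
  have hpos : ∫ x in annulus N 1 2, (1 : ℝ) ≠ 0 := by
    have hne : (annulus N 1 2).Nonempty := by
      refine ⟨EuclideanSpace.single i (3 / 2), ?_⟩
      simp [annulus]
      norm_num
    have hv := (s15_annulus_meas N 1 2).measure_pos volume hne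
    have hI : IntegrableOn (fun _ => (1 : ℝ)) (annulus N 1 2) :=
      s15_integrable _ _ _ _ continuousOn_const
    have hf : volume (annulus N 1 2) < ⊤ := by
      refine lt_of_le_of_lt (measure_mono ?_) (s15_compact N 1 2).measure_lt_top
      intro x hx
      exact ⟨hx.1.le, hx.2.le⟩
    simp only [integral_const, smul_eq_mul, mul_one, measureReal_restrict_apply_univ]
    exact (ENNReal.toReal_pos hv.ne' hf.ne).ne'
  rw [P1] at hpos
  exact (mul_eq_zero.mp P2.symm).resolve_right (right_ne_zero_of_mul hpos)

lemma s15_comb (N : ℕ) (hN : 3 ≤ N) (R₀ R₁ : ℝ) (hR₀ : 0 < R₀) (G1 G2 : ℝ → ℝ)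
    (h1 : ContinuousOn G1 (Icc R₀ R₁)) (h2 : ContinuousOn G2 (Icc R₀ R₁)) (i : Fin N) :
    ∫ x in annulus N R₀ R₁, (G1 ‖x‖ * (1 - N * x i ^ 2 / ‖x‖ ^ 2) ^ 2
      + 4 * N ^ 2 * G2 ‖x‖ * (x i ^ 2 / ‖x‖ ^ 2 * (1 - x i ^ 2 / ‖x‖ ^ 2)))
    = (2 * N - 2) / (N + 2) * ∫ x in annulus N R₀ R₁, (G1 ‖x‖ + 2 * N * G2 ‖x‖) := by
  have hA : MeasurableSet (annulus N R₀ R₁) := (s15_annulus_meas N R₀ R₁).measurableSet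
  have hN0 : (0 : ℝ) < N := by exact_mod_cast (by omega : 0 < N)
  have hne : ∀ r ∈ Icc R₀ R₁, r ≠ 0 := fun r hr => (lt_of_lt_of_le hR₀ hr.1).ne'
  set P : ℝ → ℝ := fun r => (4 * N ^ 2 * G2 r - 2 * N * G1 r) / r ^ 2 with hP
  set Q : ℝ → ℝ := fun r => (N ^ 2 * G1 r - 4 * N ^ 2 * G2 r) / r ^ 4 with hQ
  have cP : ContinuousOn P (Icc R₀ R₁) :=
    ((continuousOn_const.mul h2).sub (continuousOn_const.mul h1)).div (by fun_prop)
      (fun r hr => pow_ne_zero _ (hne r hr))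
  have cQ : ContinuousOn Q (Icc R₀ R₁) :=
    ((continuousOn_const.mul h1).sub (continuousOn_const.mul h2)).div (by fun_prop)
      (fun r hr => pow_ne_zero _ (hne r hr))
  have I1 : IntegrableOn (fun x => G1 ‖x‖) (annulus N R₀ R₁) :=
    s15_integrable _ _ _ _ (s15_cont_norm h1)
  have I2 : IntegrableOn (fun x => G2 ‖x‖) (annulus N R₀ R₁) :=
    s15_integrable _ _ _ _ (s15_cont_norm h2)
  have I3 : IntegrableOn (fun x => P ‖x‖ * x i ^ 2) (annulus N R₀ R₁) :=
    s15_integrable _ _ _ _ ((s15_cont_norm cP).mul (by fun_prop))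
  have I4 : IntegrableOn (fun x => Q ‖x‖ * x i ^ 4) (annulus N R₀ R₁) :=
    s15_integrable _ _ _ _ ((s15_cont_norm cQ).mul (by fun_prop))
  have I34 : IntegrableOn (fun x => P ‖x‖ * x i ^ 2 + Q ‖x‖ * x i ^ 4) (annulus N R₀ R₁) :=
    I3.add I4
  have e1 : ∫ x in annulus N R₀ R₁, (G1 ‖x‖ * (1 - N * x i ^ 2 / ‖x‖ ^ 2) ^ 2
      + 4 * N ^ 2 * G2 ‖x‖ * (x i ^ 2 / ‖x‖ ^ 2 * (1 - x i ^ 2 / ‖x‖ ^ 2)))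
      = ∫ x in annulus N R₀ R₁, (G1 ‖x‖ + (P ‖x‖ * x i ^ 2 + Q ‖x‖ * x i ^ 4)) := by
    apply setIntegral_congr_fun hA
    intro x hx
    have : 0 < ‖x‖ := by linarith [hx.1]
    simp only [hP, hQ]
    field_simp
    ring
  have e2 : ∫ x in annulus N R₀ R₁, P ‖x‖ * ‖x‖ ^ 2
      = ∫ x in annulus N R₀ R₁, (4 * N ^ 2 * G2 ‖x‖ - 2 * N * G1 ‖x‖) := by
    apply setIntegral_congr_fun hA
    intro x hx
    have : 0 < ‖x‖ := by linarith [hx.1]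
    simp only [hP]
    field_simp
  have e3 : ∫ x in annulus N R₀ R₁, Q ‖x‖ * ‖x‖ ^ 4
      = ∫ x in annulus N R₀ R₁, (N ^ 2 * G1 ‖x‖ - 4 * N ^ 2 * G2 ‖x‖) := by
    apply setIntegral_congr_fun hA
    intro x hx
    have : 0 < ‖x‖ := by linarith [hx.1]
    simp only [hQ]
    field_simp
  have A2 := s15_A2 N R₀ R₁ P cP i
  have A4 := s15_A4 N R₀ R₁ Q cQ i
  rw [e2, integral_sub (I2.const_mul _) (I1.const_mul _), integral_const_mul,
    integral_const_mul] at A2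
  rw [e3, integral_sub (I1.const_mul _) (I2.const_mul _), integral_const_mul,
    integral_const_mul] at A4
  rw [e1, integral_add I1 I34, integral_add I3 I4, integral_add I1 (I2.const_mul _),
    integral_const_mul]
  generalize (∫ x in annulus N R₀ R₁, P ‖x‖ * x i ^ 2) = X at *
  generalize (∫ x in annulus N R₀ R₁, Q ‖x‖ * x i ^ 4) = Y at *
  generalize (∫ x in annulus N R₀ R₁, G1 ‖x‖) = a at *
  generalize (∫ x in annulus N R₀ R₁, G2 ‖x‖) = b at *
  have hX : X = 4 * N * b - 2 * a := by
    apply mul_left_cancel₀ hN0.ne'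
    rw [A2]; ring
  have hY : Y = 3 * (N * a - 4 * N * b) / (N + 2) := by
    field_simp
    apply mul_left_cancel₀ hN0.ne'
    linarith
  rw [hX, hY]
  field_simp
  ring

lemma s15_radial (N : ℕ) (hN : 3 ≤ N) (R₀ R₁ : ℝ) (hR₀ : 0 < R₀) (hR : R₀ < R₁) :
    ∃ c : ℝ, 0 < c ∧ ∀ h : ℝ → ℝ, ∫ x in annulus N R₀ R₁, h ‖x‖
      = c * ∫ r in R₀..R₁, r ^ (N - 1) * h r := by
  have : Nonempty (Fin N) := ⟨⟨0, by omega⟩⟩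
  have hne : Nontrivial (EuclideanSpace ℝ (Fin N)) := inferInstance
  have hA : MeasurableSet (annulus N R₀ R₁) := (s15_annulus_meas N R₀ R₁).measurableSet
  refine ⟨N * (volume : Measure (EuclideanSpace ℝ (Fin N))).real (Metric.ball 0 1), ?_, ?_⟩
  · apply mul_pos (by exact_mod_cast (by omega : 0 < N))
    exact ENNReal.toReal_pos (Metric.measure_ball_pos volume _ one_pos).ne' measure_ball_lt_top.ne
  · intro h
    have h1 := integral_fun_norm_addHaar (volume : Measure (EuclideanSpace ℝ (Fin N)))
      ((Ioo R₀ R₁).indicator h)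
    have h2 : ∫ x : EuclideanSpace ℝ (Fin N), (Ioo R₀ R₁).indicator h ‖x‖
        = ∫ x in annulus N R₀ R₁, h ‖x‖ := by
      rw [← integral_indicator hA]
      rfl
    have h3 : ∫ y in Ioi (0 : ℝ), y ^ (N - 1) • (Ioo R₀ R₁).indicator h y
        = ∫ r in R₀..R₁, r ^ (N - 1) * h r := by
      rw [intervalIntegral.integral_of_le hR.le, integral_Ioc_eq_integral_Ioo]
      have h4 : (fun y : ℝ => y ^ (N - 1) • (Ioo R₀ R₁).indicator h y)
          = (Ioo R₀ R₁).indicator (fun r => r ^ (N - 1) * h r) := by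
        ext y
        by_cases hy : y ∈ Ioo R₀ R₁ <;> simp [hy]
      rw [h4, setIntegral_indicator measurableSet_Ioo]
      congr 2
      ext y
      constructor
      · rintro ⟨_, h⟩; exact h
      · intro h; exact ⟨hR₀.trans h.1, h⟩
    rw [← h2, h1]
    simp only [finrank_euclideanSpace, Fintype.card_fin]
    rw [h3]
    simp [mul_assoc]

lemma s15_grad (N : ℕ) (w : ℝ → ℝ) (d : ℝ) (i : Fin N) (x : EuclideanSpace ℝ (Fin N))
    (hx : 0 < ‖x‖) (hw : HasDerivAt w d ‖x‖) :
    ‖fderiv ℝ (fun y : EuclideanSpace ℝ (Fin N) => w ‖y‖ * (1 - N * y i ^ 2 / ‖y‖ ^ 2)) x‖ ^ 2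
      = d ^ 2 * (1 - N * x i ^ 2 / ‖x‖ ^ 2) ^ 2
        + 4 * N ^ 2 * (w ‖x‖ ^ 2 / ‖x‖ ^ 2) * (x i ^ 2 / ‖x‖ ^ 2 * (1 - x i ^ 2 / ‖x‖ ^ 2)) := by
  have hx0 : x ≠ 0 := norm_pos_iff.mp hx
  set e : EuclideanSpace ℝ (Fin N) := EuclideanSpace.single i 1 with he
  have hsq : HasFDerivAt (fun y : EuclideanSpace ℝ (Fin N) => ‖y‖ ^ 2) (2 • innerSL ℝ x) x :=
    (hasStrictFDerivAt_norm_sq x).hasFDerivAt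
  have hn : HasFDerivAt (fun y : EuclideanSpace ℝ (Fin N) => ‖y‖) ((1 / ‖x‖) • innerSL ℝ x) x := by
    have := hsq.sqrt (by positivity)
    simp only [Real.sqrt_sq (norm_nonneg _)] at this
    convert! this using 1
    ext y
    simp
    field_simp
  have hwn : HasFDerivAt (fun y : EuclideanSpace ℝ (Fin N) => w ‖y‖)
      (d • ((1 / ‖x‖) • innerSL ℝ x)) x := hw.comp_hasFDerivAt x hn
  have hc : HasFDerivAt (fun y : EuclideanSpace ℝ (Fin N) => y i) (innerSL ℝ e) x := by
    have : (fun y : EuclideanSpace ℝ (Fin N) => y i) = fun y => innerSL ℝ e y := by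
      ext y
      simp [he, EuclideanSpace.inner_single_left]
    rw [this]
    exact (innerSL ℝ e).hasFDerivAt
  have hinv : HasFDerivAt (fun y : EuclideanSpace ℝ (Fin N) => (‖y‖ ^ 2)⁻¹)
      ((-((‖x‖ ^ 2) ^ 2)⁻¹) • (2 • innerSL ℝ x)) x :=
    (hasDerivAt_inv (by positivity)).comp_hasFDerivAt x hsq
  have hg := ((((hc.pow 2).const_mul (N : ℝ)).mul hinv).const_sub 1)
  have hv := hwn.mul hg
  set a : ℝ := d / ‖x‖ * (1 - N * x i ^ 2 / ‖x‖ ^ 2) + 2 * N * w ‖x‖ * x i ^ 2 / ‖x‖ ^ 4 with ha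
  set b : ℝ := - 2 * N * w ‖x‖ * x i / ‖x‖ ^ 2 with hb
  have hv' : HasFDerivAt (fun y : EuclideanSpace ℝ (Fin N) => w ‖y‖ * (1 - N * y i ^ 2 / ‖y‖ ^ 2))
      (innerSL ℝ (a • x + b • e)) x := by
    convert! hv using 1
    ext y
    simp [inner_add_left, inner_smul_left]
    rw [ha, hb]
    field_simp
    ring
  rw [hv'.fderiv, innerSL_apply_norm, norm_add_sq_real, norm_smul, norm_smul, inner_smul_left,
    inner_smul_right]
  have hxe : inner ℝ x e = x i := by simp [he, EuclideanSpace.inner_single_right]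
  have hne : ‖e‖ = 1 := by simp [he]
  rw [hxe, hne, mul_pow, mul_pow, Real.norm_eq_abs, Real.norm_eq_abs, sq_abs, sq_abs]
  simp only [conj_trivial]
  rw [ha, hb]
  field_simp
  ring

/-- the function `v(x) = w(|x|)(1 − N x_N²/|x|²)` built from an eigenfunction of the
radial linearized problem with `α + 2N < 0` satisfies the instability conditions (1)-(4). -/
theorem statement15 (N : ℕ) (hN : 3 ≤ N) (R₀ R₁ : ℝ) (hR₀ : 0 < R₀) (hR : R₀ < R₁)
    (p : ℝ) (hp : 2 < p) (U : ℝ → ℝ)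
    (hUcont : ContinuousOn U (Icc R₀ R₁)) (hUpos : ∀ r ∈ Icc R₀ R₁, 0 ≤ U r)
    (α : ℝ) (w : ℝ → ℝ)
    (hw1 : ContDiffOn ℝ 1 w (Icc R₀ R₁)) (hw2 : ContDiffOn ℝ 2 w (Ioo R₀ R₁))
    (hwpos : ∀ r ∈ Ioo R₀ R₁, 0 < w r) (hw0 : w R₀ = 0) (hw1' : w R₁ = 0)
    (hode : ∀ r ∈ Ioo R₀ R₁,
      -deriv (deriv w) r - ((N - 1) / r) * deriv w r
        + (1 - (p - 1) * U r ^ (p - 2)) * w r = (α / r ^ 2) * w r)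
    (hα : α + 2 * N < 0) :
    memC10 N R₀ R₁ (fun x => w ‖x‖ * (1 - N * lastCoord x ^ 2 / ‖x‖ ^ 2)) ∧
    IsAxiallySymmRep N R₀ R₁ (fun x => w ‖x‖ * (1 - N * lastCoord x ^ 2 / ‖x‖ ^ 2))
      (fun r θ => w r * (1 - N * Real.sin θ ^ 2)) ∧
    (∫ x in annulus N R₀ R₁,
        (‖fderivWithin ℝ (fun y => w ‖y‖ * (1 - N * lastCoord y ^ 2 / ‖y‖ ^ 2))
            (closure (annulus N R₀ R₁)) x‖ ^ 2
          + (w ‖x‖ * (1 - N * lastCoord x ^ 2 / ‖x‖ ^ 2)) ^ 2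
          - (p - 1) * U ‖x‖ ^ (p - 2)
              * (w ‖x‖ * (1 - N * lastCoord x ^ 2 / ‖x‖ ^ 2)) ^ 2)) < 0 ∧
    (∀ r ∈ Icc R₀ R₁,
      AntitoneOn (fun θ => w r * (1 - N * Real.sin θ ^ 2)) (Icc 0 (π / 2))) ∧
    (∀ r ∈ Icc R₀ R₁, ∀ θ : ℝ,
      w r * (1 - N * Real.sin (-θ) ^ 2) = w r * (1 - N * Real.sin θ ^ 2)) ∧
    (∀ r ∈ Ioo R₀ R₁,
      (∫ σ : Metric.sphere (0 : EuclideanSpace ℝ (Fin N)) 1,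
        (w ‖r • (σ : EuclideanSpace ℝ (Fin N))‖
          * (1 - N * lastCoord (r • (σ : EuclideanSpace ℝ (Fin N))) ^ 2
              / ‖r • (σ : EuclideanSpace ℝ (Fin N))‖ ^ 2))
        ∂((volume : Measure (EuclideanSpace ℝ (Fin N))).toSphere)) = 0) := by
  set i : Fin N := ⟨N - 1, by omega⟩ with hi
  have hlast : ∀ x : EuclideanSpace ℝ (Fin N), lastCoord x = x i := by
    intro x
    simp only [lastCoord, dif_pos (by omega : 0 < N), hi]
  simp only [hlast]
  have hN0 : (0 : ℝ) < N := by exact_mod_cast (by omega : 0 < N)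
  have hA : MeasurableSet (annulus N R₀ R₁) := (s15_annulus_meas N R₀ R₁).measurableSet
  have hwnn : ∀ r ∈ Icc R₀ R₁, 0 ≤ w r := by
    intro r hr
    rcases eq_or_lt_of_le hr.1 with h | h
    · rw [← h, hw0]
    rcases eq_or_lt_of_le hr.2 with h' | h'
    · rw [h', hw1']
    exact (hwpos r ⟨h, h'⟩).le
  have hC1 : ContDiffOn ℝ 1 (fun x : EuclideanSpace ℝ (Fin N) =>
      w ‖x‖ * (1 - N * x i ^ 2 / ‖x‖ ^ 2)) {x | ‖x‖ ∈ Icc R₀ R₁} := by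
    have hne : ∀ x ∈ {x : EuclideanSpace ℝ (Fin N) | ‖x‖ ∈ Icc R₀ R₁}, x ≠ 0 := by
      intro x hx
      exact norm_pos_iff.mp (lt_of_lt_of_le hR₀ hx.1)
    have hn : ContDiffOn ℝ 1 (fun x : EuclideanSpace ℝ (Fin N) => ‖x‖) {x | ‖x‖ ∈ Icc R₀ R₁} :=
      fun x hx => (contDiffAt_norm ℝ (hne x hx)).contDiffWithinAt
    have hc : ContDiffOn ℝ 1 (fun x : EuclideanSpace ℝ (Fin N) => x i) {x | ‖x‖ ∈ Icc R₀ R₁} :=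
      (EuclideanSpace.proj (𝕜 := ℝ) i).contDiff.contDiffOn
    refine (hw1.comp hn (fun x hx => hx)).mul (contDiffOn_const.sub
      ((contDiffOn_const.mul (hc.pow 2)).div (hn.pow 2) ?_))
    intro x hx
    exact pow_ne_zero _ (norm_ne_zero_iff.mpr (hne x hx))
  refine ⟨⟨hC1.mono (s15_closed_sub N R₀ R₁), ?_⟩, ?_, ?_, ?_, ?_, ?_⟩
  · rintro x (h | h) <;> simp [h, hw0, hw1']
  · intro x hx
    have hx' := s15_closed_sub N R₀ R₁ hx
    have hpos : 0 < ‖x‖ := lt_of_lt_of_le hR₀ hx'.1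
    have hle : |x i| ≤ ‖x‖ := by
      simpa using PiLp.norm_apply_le x i
    have hb := abs_le.mp hle
    simp only [angleOf, hlast]
    rw [Real.sin_arcsin, div_pow, mul_div_assoc]
    · rw [le_div_iff₀ hpos]; linarith
    · rw [div_le_one hpos]; linarith
  · -- the energy inequality
    set D : ℝ → ℝ := derivWithin w (Icc R₀ R₁) with hD
    have hDc : ContinuousOn D (Icc R₀ R₁) :=
      hw1.continuousOn_derivWithin (uniqueDiffOn_Icc hR) le_rfl
    have hDd : ∀ r ∈ Ioo R₀ R₁, HasDerivAt w (D r) r := by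
      intro r hr
      have h1 := (hw1.differentiableOn one_ne_zero r (Ioo_subset_Icc_self hr)).hasDerivWithinAt
      exact h1.hasDerivAt (Icc_mem_nhds hr.1 hr.2)
    have hwc : ContinuousOn w (Icc R₀ R₁) := hw1.continuousOn
    set K : ℝ → ℝ := fun r => 1 - (p - 1) * U r ^ (p - 2) with hK
    have hKc : ContinuousOn K (Icc R₀ R₁) :=
      continuousOn_const.sub (continuousOn_const.mul
        (hUcont.rpow_const (fun x _ => Or.inr (by linarith))))
    have hW2 : ContinuousOn (fun r => w r ^ 2 / r ^ 2) (Icc R₀ R₁) :=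
      (hwc.pow 2).div (by fun_prop) (fun r hr => pow_ne_zero _ (lt_of_lt_of_le hR₀ hr.1).ne')
    have hG1 : ContinuousOn (fun r => D r ^ 2 + K r * w r ^ 2) (Icc R₀ R₁) :=
      (hDc.pow 2).add (hKc.mul (hwc.pow 2))
    have hcomb := s15_comb N hN R₀ R₁ hR₀ (fun r => D r ^ 2 + K r * w r ^ 2)
      (fun r => w r ^ 2 / r ^ 2) hG1 hW2 i
    have hint : ∫ x in annulus N R₀ R₁,
        (‖fderivWithin ℝ (fun y : EuclideanSpace ℝ (Fin N) =>
            w ‖y‖ * (1 - N * y i ^ 2 / ‖y‖ ^ 2)) (closure (annulus N R₀ R₁)) x‖ ^ 2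
          + (w ‖x‖ * (1 - N * x i ^ 2 / ‖x‖ ^ 2)) ^ 2
          - (p - 1) * U ‖x‖ ^ (p - 2) * (w ‖x‖ * (1 - N * x i ^ 2 / ‖x‖ ^ 2)) ^ 2)
        = ∫ x in annulus N R₀ R₁,
          ((D ‖x‖ ^ 2 + K ‖x‖ * w ‖x‖ ^ 2) * (1 - N * x i ^ 2 / ‖x‖ ^ 2) ^ 2
          + 4 * N ^ 2 * (w ‖x‖ ^ 2 / ‖x‖ ^ 2)
            * (x i ^ 2 / ‖x‖ ^ 2 * (1 - x i ^ 2 / ‖x‖ ^ 2))) := by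
      apply setIntegral_congr_fun hA
      intro x hx
      have hnb : closure (annulus N R₀ R₁) ∈ nhds x :=
        Filter.mem_of_superset ((s15_annulus_meas N R₀ R₁).mem_nhds hx) subset_closure
      simp only
      rw [fderivWithin_of_mem_nhds hnb, s15_grad N w (D ‖x‖) i x (hR₀.trans hx.1) (hDd _ hx)]
      simp only [hK]
      ring
    rw [hint, hcomb]
    obtain ⟨c, hc, hrad⟩ := s15_radial N hN R₀ R₁ hR₀ hR
    rw [hrad (fun r => D r ^ 2 + K r * w r ^ 2 + 2 * N * (w r ^ 2 / r ^ 2))]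
    -- integration by parts
    have hf'c : ContinuousOn (fun r => r ^ (N - 1) * (D r ^ 2 + K r * w r ^ 2
        - α * (w r ^ 2 / r ^ 2))) (Icc R₀ R₁) :=
      ContinuousOn.mul (by fun_prop) (hG1.sub (continuousOn_const.mul hW2))
    have hzc : ContinuousOn (fun r => r ^ (N - 1) * (w r ^ 2 / r ^ 2)) (Icc R₀ R₁) :=
      ContinuousOn.mul (by fun_prop) hW2
    have hf'i : IntervalIntegrable (fun r => r ^ (N - 1) * (D r ^ 2 + K r * w r ^ 2
        - α * (w r ^ 2 / r ^ 2))) volume R₀ R₁ := hf'c.intervalIntegrable_of_Icc hR.le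
    have hzi : IntervalIntegrable (fun r => r ^ (N - 1) * (w r ^ 2 / r ^ 2)) volume R₀ R₁ :=
      hzc.intervalIntegrable_of_Icc hR.le
    have hparts : ∫ r in R₀..R₁, r ^ (N - 1) * (D r ^ 2 + K r * w r ^ 2
        - α * (w r ^ 2 / r ^ 2)) = 0 := by
      have hder : ∀ r ∈ Ioo R₀ R₁, HasDerivAt (fun r => r ^ (N - 1) * (D r * w r))
          (r ^ (N - 1) * (D r ^ 2 + K r * w r ^ 2 - α * (w r ^ 2 / r ^ 2))) r := by
        intro r hr
        have hr0 : 0 < r := hR₀.trans hr.1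
        have hev : D =ᶠ[nhds r] deriv w := by
          filter_upwards [isOpen_Ioo.mem_nhds hr] with y hy
          exact (hDd y hy).deriv.symm
        have hdw : DifferentiableAt ℝ (deriv w) r := by
          have h2 : ContDiffOn ℝ 1 (deriv w) (Ioo R₀ R₁) :=
            hw2.deriv_of_isOpen isOpen_Ioo (by norm_num)
          exact (h2.differentiableOn one_ne_zero).differentiableAt (isOpen_Ioo.mem_nhds hr)
        have hD2 : HasDerivAt D (deriv (deriv w) r) r :=
          hdw.hasDerivAt.congr_of_eventuallyEq hev
        have hprod := (hasDerivAt_pow (N - 1) r).fun_mul (hD2.fun_mul (hDd r hr))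
        convert! hprod using 1
        have ho := hode r hr
        rw [(hDd r hr).deriv] at ho
        have ho' : deriv (deriv w) r = - ((N - 1) / r) * D r + K r * w r - (α / r ^ 2) * w r := by
          simp only [hK]; linarith
        rw [ho']
        obtain ⟨m, rfl⟩ : ∃ m, N = m + 2 := ⟨N - 2, by omega⟩
        simp only [show m + 2 - 1 = m + 1 by omega, Nat.add_sub_cancel]
        push_cast
        field_simp
        ring
      have hcont : ContinuousOn (fun r => r ^ (N - 1) * (D r * w r)) (Icc R₀ R₁) :=
        ContinuousOn.mul (by fun_prop) (hDc.mul hwc)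
      rw [intervalIntegral.integral_eq_sub_of_hasDerivAt_of_le hR.le hcont hder hf'i]
      simp [hw0, hw1']
    have hsplit : ∫ r in R₀..R₁, r ^ (N - 1) * (D r ^ 2 + K r * w r ^ 2
        + 2 * N * (w r ^ 2 / r ^ 2))
        = (α + 2 * N) * ∫ r in R₀..R₁, r ^ (N - 1) * (w r ^ 2 / r ^ 2) := by
      rw [← intervalIntegral.integral_const_mul, ← sub_eq_zero,
        ← intervalIntegral.integral_sub, ← hparts]
      · congr 1
        ext r
        ring
      · exact (ContinuousOn.mul (by fun_prop)
          (hG1.add (continuousOn_const.mul hW2))).intervalIntegrable_of_Icc hR.le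
      · exact hzi.const_mul _
    rw [hsplit]
    have hpos : 0 < ∫ r in R₀..R₁, r ^ (N - 1) * (w r ^ 2 / r ^ 2) := by
      apply intervalIntegral.intervalIntegral_pos_of_pos_on hzi _ hR
      intro r hr
      have hr0 : 0 < r := hR₀.trans hr.1
      have := hwpos r hr
      positivity
    have hN3 : (3 : ℝ) ≤ N := by exact_mod_cast hN
    have hfac : 0 < (2 * (N : ℝ) - 2) / (N + 2) := div_pos (by linarith) (by linarith)
    exact mul_neg_of_pos_of_neg hfac (mul_neg_of_pos_of_neg hc (mul_neg_of_neg_of_pos hα hpos))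
  · intro r hr a ha b hb hab
    have h1 : Real.sin a ≤ Real.sin b :=
      Real.sin_le_sin_of_le_of_le_pi_div_two (by linarith [ha.1, Real.pi_pos]) hb.2 hab
    have h0 : 0 ≤ Real.sin a := Real.sin_nonneg_of_nonneg_of_le_pi ha.1 (by linarith [ha.2, Real.pi_pos])
    have h2 : Real.sin a ^ 2 ≤ Real.sin b ^ 2 := pow_le_pow_left₀ h0 h1 2
    exact mul_le_mul_of_nonneg_left (by nlinarith) (hwnn r hr)
  · intro r _ θ
    simp
  · intro r hr
    have hr0 : 0 < r := hR₀.trans hr.1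
    have h1 : ∀ σ : Metric.sphere (0 : EuclideanSpace ℝ (Fin N)) 1,
        w ‖r • (σ : EuclideanSpace ℝ (Fin N))‖
          * (1 - N * (r • (σ : EuclideanSpace ℝ (Fin N))) i ^ 2
              / ‖r • (σ : EuclideanSpace ℝ (Fin N))‖ ^ 2)
        = w r * (1 - N * (σ : EuclideanSpace ℝ (Fin N)) i ^ 2) := by
      intro σ
      have hn : ‖r • (σ : EuclideanSpace ℝ (Fin N))‖ = r := by
        rw [norm_smul, norm_eq_of_mem_sphere, Real.norm_eq_abs, abs_of_pos hr0, mul_one]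
      rw [hn, PiLp.smul_apply, smul_eq_mul]
      field_simp
    simp_rw [h1]
    rw [integral_const_mul, s15_sphere N hN i, mul_zero]
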